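/- Let d ∈ ℕ, 1 ≤ q < ∞ and let s be sufficiently large (i.e. s > d(1 − 1/q) if q > 1 and s ≥ 0 if q = 1). Then there exists a constant C = C(d, q, s) > 0 such that for all a, b : ℤ^d → ℂ with ‖a‖_{q,s} < ∞ and ‖b‖_{q,s} < ∞, the convolution (a ∗ b)_k := ∑_{m ∈ ℤ^d} a_{k−m} b_m converges absolutely for every k ∈ ℤ^d, and ‖a ∗ b‖_{q,s} ≤ C ‖a‖_{q,s} ‖b‖_{q,s}. In other words, the weighted sequence space l^q_s(ℤ^d) is a Banach algebra under convolution. -/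

import Mathlib

open scoped ENNReal NNReal

/-- The Japanese bracket `⟨k⟩ = (1 + |k|²)^(1/2)` of a lattice point `k ∈ ℤ^d`. -/
noncomputable def jb {d : ℕ} (k : Fin d → ℤ) : ℝ :=
  Real.sqrt (1 + ∑ i, ((k i : ℝ)) ^ 2)

/-- Unweighted `ℓ^q` norm (`q ∈ [1,∞]`) of a real-valued family, valued in `ℝ≥0∞`. -/
noncomputable def lqNorm {ι : Type*} (q : ℝ≥0∞) (f : ι → ℝ) : ℝ≥0∞ :=
  if q = ∞ then ⨆ i, (‖f i‖₊ : ℝ≥0∞)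
  else (∑' i, (‖f i‖₊ : ℝ≥0∞) ^ q.toReal) ^ (1 / q.toReal)

/-- The weighted norm `‖a‖_{q,s}` on sequences `a : ℤ^d → ℂ`. -/
noncomputable def wnorm (d : ℕ) (q : ℝ≥0∞) (s : ℝ) (a : (Fin d → ℤ) → ℂ) : ℝ≥0∞ :=
  lqNorm q (fun k => jb k ^ s * ‖a k‖)

/-- `s` is sufficiently large: `s > d(1 - 1/q)` if `q > 1`, `s ≥ 0` if `q = 1`.
(For `q = ∞` one has `q.toReal = 0` and `1/0 = 0` in `ℝ`, so the condition reads `s > d`.) -/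
def SuffLarge (d : ℕ) (q : ℝ≥0∞) (s : ℝ) : Prop :=
  if q = 1 then 0 ≤ s else (d : ℝ) * (1 - 1 / q.toReal) < s

theorem norm_intCast_le_jb {d : ℕ} (k : Fin d → ℤ) : ‖(fun i => (k i : ℝ))‖ ≤ jb k := by
  refine (pi_norm_le_iff_of_nonneg (Real.sqrt_nonneg _)).2 fun i => ?_
  rw [Real.norm_eq_abs]
  refine Real.abs_le_sqrt ?_
  have := Finset.single_le_sum (f := fun i => (k i : ℝ) ^ 2) (fun i _ => sq_nonneg _)
    (Finset.mem_univ i)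
  linarith

theorem one_le_jb {d : ℕ} (k : Fin d → ℤ) : 1 ≤ jb k := by
  refine Real.one_le_sqrt.2 ?_
  have : 0 ≤ ∑ i, (k i : ℝ) ^ 2 := Finset.sum_nonneg fun i _ => sq_nonneg _
  linarith

theorem jb_add_le {d : ℕ} (k m : Fin d → ℤ) : jb (k + m) ≤ jb k + jb m := by
  have key (x y : EuclideanSpace ℝ (Fin d)) :
      √(1 + ‖x + y‖ ^ 2) ≤ √(1 + ‖x‖ ^ 2) + √(1 + ‖y‖ ^ 2) := by
    refine Real.sqrt_le_iff.2 ⟨by positivity, ?_⟩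
    have hx := Real.sq_sqrt (show 0 ≤ 1 + ‖x‖ ^ 2 by positivity)
    have hy := Real.sq_sqrt (show 0 ≤ 1 + ‖y‖ ^ 2 by positivity)
    have hx' : ‖x‖ ≤ √(1 + ‖x‖ ^ 2) := Real.le_sqrt_of_sq_le (by linarith)
    have hy' : ‖y‖ ≤ √(1 + ‖y‖ ^ 2) := Real.le_sqrt_of_sq_le (by linarith)
    have h1 := mul_le_mul hx' hy' (norm_nonneg _) (Real.sqrt_nonneg _)
    have h2 := pow_le_pow_left₀ (norm_nonneg _) (norm_add_le x y) 2
    nlinarith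
  have := key (WithLp.toLp 2 fun i => (k i : ℝ)) (WithLp.toLp 2 fun i => (m i : ℝ))
  simpa [jb, EuclideanSpace.norm_sq_eq] using this

theorem summable_jb_rpow {d : ℕ} {r : ℝ} (hr : r < -d) :
    Summable fun k : Fin d → ℤ => jb k ^ r := by
  let b := Pi.basisFun ℝ (Fin d)
  let L := Submodule.span ℤ (Set.range b)
  have hrank : Module.finrank ℤ L = d := by
    rw [ZLattice.rank ℝ L]; simp
  have hmem (k : Fin d → ℤ) : (fun i => (k i : ℝ)) ∈ L :=
    (b.mem_span_iff_repr_mem ℤ _).2 fun i => ⟨k i, by simp [b]⟩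
  have hinj : Function.Injective fun k : Fin d → ℤ => (⟨_, hmem k⟩ : L) := by
    intro k m h
    funext i
    simpa using congrFun (congrArg Subtype.val h) i
  have hsum := (ZLattice.summable_norm_rpow L r (by rwa [hrank])).comp_injective hinj
  refine Summable.of_norm_bounded_eventually hsum ?_
  refine (Set.finite_singleton (0 : Fin d → ℤ)).subset fun k hk => ?_
  by_contra hk0
  refine hk ?_
  have hpos : 0 < ‖(fun i => (k i : ℝ))‖ := by
    refine norm_pos_iff.2 fun h => hk0 ?_
    funext i
    simpa using congrFun h i
  have hd' : (0 : ℝ) ≤ d := d.cast_nonneg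
  have hjb : 0 ≤ jb k := Real.sqrt_nonneg _
  change ‖jb k ^ r‖ ≤ ‖(fun i => (k i : ℝ))‖ ^ r
  rw [Real.norm_of_nonneg (by positivity)]
  exact Real.rpow_le_rpow_of_nonpos hpos (norm_intCast_le_jb k) (by linarith)

namespace ENNReal

theorem inner_le_weight_mul_Lp_tsum {ι : Type*} {p : ℝ} (hp : 1 ≤ p) (w f : ι → ℝ≥0∞) :
    ∑' i, w i * f i ≤ (∑' i, w i) ^ (1 - p⁻¹) * (∑' i, w i * f i ^ p) ^ p⁻¹ := by
  rw [ENNReal.tsum_eq_iSup_sum]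
  refine iSup_le fun t => (inner_le_weight_mul_Lp_of_nonneg t hp w f).trans ?_
  have : p⁻¹ ≤ 1 := inv_le_one_of_one_le₀ hp
  have hw := rpow_le_rpow (ENNReal.sum_le_tsum (f := w) t) (sub_nonneg.2 this)
  gcongr
  exact ENNReal.sum_le_tsum t

theorem Lp_add_le_tsum {ι : Type*} {p : ℝ} (hp : 1 ≤ p) (f g : ι → ℝ≥0∞) :
    (∑' i, (f i + g i) ^ p) ^ (1 / p) ≤
      (∑' i, f i ^ p) ^ (1 / p) + (∑' i, g i ^ p) ^ (1 / p) := by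
  have hp0 : 0 < p := by linarith
  rw [one_div, rpow_inv_le_iff hp0, ENNReal.tsum_eq_iSup_sum]
  refine iSup_le fun t => ?_
  rw [← rpow_inv_le_iff hp0, ← one_div]
  refine (Lp_add_le t f g hp).trans ?_
  gcongr <;> exact ENNReal.sum_le_tsum t

/-- Young's convolution inequality `‖f ∗ g‖_p ≤ ‖f‖_p ‖g‖_1`. -/
theorem Lp_tsum_conv_le {G : Type*} [AddCommGroup G] {p : ℝ} (hp : 1 ≤ p) (f g : G → ℝ≥0∞) :
    (∑' k, (∑' m, f (k - m) * g m) ^ p) ^ (1 / p) ≤ (∑' k, f k ^ p) ^ (1 / p) * ∑' m, g m := by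
  have hp0 : 0 < p := by linarith
  have hp0' : p ≠ 0 := hp0.ne'
  have hpt (k : G) : (∑' m, f (k - m) * g m) ^ p ≤
      (∑' m, g m) ^ (p - 1) * ∑' m, g m * f (k - m) ^ p := by
    have h := rpow_le_rpow (inner_le_weight_mul_Lp_tsum hp g fun m => f (k - m)) hp0.le
    rw [mul_rpow_of_nonneg _ _ hp0.le, ← rpow_mul, ← rpow_mul, inv_mul_cancel₀ hp0', rpow_one,
      sub_mul, one_mul, inv_mul_cancel₀ hp0'] at h
    simpa only [mul_comm] using h
  have hshift (m : G) : ∑' k, f (k - m) ^ p = ∑' k, f k ^ p :=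
    (Equiv.subRight m).tsum_eq fun k => f k ^ p
  rw [one_div, rpow_inv_le_iff hp0, mul_rpow_of_nonneg _ _ hp0.le, ← rpow_mul,
    inv_mul_cancel₀ hp0', rpow_one]
  calc ∑' k, (∑' m, f (k - m) * g m) ^ p
      ≤ ∑' k, (∑' m, g m) ^ (p - 1) * ∑' m, g m * f (k - m) ^ p := ENNReal.tsum_le_tsum hpt
    _ = (∑' m, g m) ^ (p - 1) * ((∑' m, g m) * ∑' k, f k ^ p) := by
        rw [ENNReal.tsum_mul_left, ENNReal.tsum_comm]
        simp_rw [ENNReal.tsum_mul_left, hshift, ENNReal.tsum_mul_right]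
    _ = (∑' k, f k ^ p) * (∑' m, g m) ^ p := by
        have : (∑' m, g m) ^ p = (∑' m, g m) ^ (p - 1) * ∑' m, g m := by
          conv_lhs => rw [← sub_add_cancel p 1]
          rw [rpow_add_of_nonneg _ _ (by linarith) zero_le_one, rpow_one]
        rw [this]; ring

end ENNReal

theorem wnorm_eq {d : ℕ} {q : ℝ≥0∞} (hq' : q ≠ ∞) (s : ℝ) (a : (Fin d → ℤ) → ℂ) :
    wnorm d q s a = (∑' k, (ENNReal.ofReal (jb k ^ s) * ‖a k‖ₑ) ^ q.toReal) ^ (1 / q.toReal) := by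
  have hjb (k : Fin d → ℤ) : 0 ≤ jb k ^ s := Real.rpow_nonneg (Real.sqrt_nonneg _) _
  simp only [wnorm, lqNorm, if_neg hq']
  congr! 4 with k
  change ‖jb k ^ s * ‖a k‖‖ₑ = _
  rw [enorm_mul, enorm_norm, Real.enorm_of_nonneg (hjb k)]

theorem SuffLarge.nonneg {d : ℕ} {q : ℝ≥0∞} {s : ℝ} (hs : SuffLarge d q s) (hq : 1 ≤ q.toReal) :
    0 ≤ s := by
  unfold SuffLarge at hs
  split_ifs at hs with h
  · exact hs
  · refine le_trans (mul_nonneg d.cast_nonneg ?_) hs.le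
    rw [one_div, sub_nonneg]
    exact inv_le_one_of_one_le₀ hq

/-- The embedding of the weighted space `ℓ^q_s` into `ℓ^1` for sufficiently large `s`. -/
theorem exists_tsum_le_mul_wnorm {d : ℕ} {q : ℝ≥0∞} (hq : 1 ≤ q) (hq' : q ≠ ∞)
    {s : ℝ} (hs : SuffLarge d q s) :
    ∃ K : ℝ≥0∞, K ≠ ∞ ∧ ∀ a : (Fin d → ℤ) → ℂ, ∑' k, ‖a k‖ₑ ≤ K * wnorm d q s a := by
  have hp1 : 1 ≤ q.toReal := by simpa using ENNReal.toReal_mono hq' hq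
  have hs0 := hs.nonneg hp1
  simp only [wnorm_eq hq']
  by_cases h1 : q = 1
  · refine ⟨1, ENNReal.one_ne_top, fun a => ?_⟩
    simp only [h1, ENNReal.toReal_one, one_div_one, ENNReal.rpow_one, one_mul]
    refine ENNReal.tsum_le_tsum fun k => le_mul_of_one_le_left' ?_
    exact ENNReal.one_le_ofReal.2 (Real.one_le_rpow (one_le_jb k) hs0)
  rw [SuffLarge, if_neg h1] at hs
  have hp : 1 < q.toReal := lt_of_le_of_ne hp1 fun h =>
    h1 (by rw [← ENNReal.ofReal_toReal hq', ← h, ENNReal.ofReal_one])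
  set p := q.toReal
  have hpc := Real.HolderConjugate.conjExponent hp
  set p' := p.conjExponent
  have hinv : 1 - 1 / p = 1 / p' := by
    have := hpc.inv_add_inv_eq_one
    simp only [one_div]; linarith
  have hsum : Summable fun k : Fin d → ℤ => (jb k ^ (-s)) ^ p' := by
    have : -s * p' < -d := by
      rw [hinv, mul_one_div, div_lt_iff₀ hpc.symm.pos] at hs
      linarith
    exact (summable_jb_rpow this).congr fun k => Real.rpow_mul (Real.sqrt_nonneg _) _ _
  refine ⟨(∑' k : Fin d → ℤ, ENNReal.ofReal (jb k ^ (-s)) ^ p') ^ (1 / p'), ?_, fun a => ?_⟩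
  · refine ENNReal.rpow_ne_top_of_nonneg (by have := hpc.symm.pos; positivity) ?_
    have hjb (k : Fin d → ℤ) : 0 ≤ jb k ^ (-s) := Real.rpow_nonneg (Real.sqrt_nonneg _) _
    simp_rw [ENNReal.ofReal_rpow_of_nonneg (hjb _) hpc.symm.nonneg]
    exact hsum.tsum_ofReal_ne_top
  · rw [ENNReal.tsum_eq_iSup_sum]
    refine iSup_le fun t => ?_
    have hk (k : Fin d → ℤ) : ‖a k‖ₑ =
        ENNReal.ofReal (jb k ^ (-s)) * (ENNReal.ofReal (jb k ^ s) * ‖a k‖ₑ) := by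
      have hpos : 0 < jb k := zero_lt_one.trans_le (one_le_jb k)
      rw [← mul_assoc, ← ENNReal.ofReal_mul (by positivity), ← Real.rpow_add hpos]
      simp
    rw [Finset.sum_congr rfl fun k _ => hk k]
    refine (ENNReal.inner_le_Lp_mul_Lq t _ _ hpc.symm).trans ?_
    have := hpc.pos
    have := hpc.symm.pos
    gcongr <;> exact ENNReal.sum_le_tsum t

theorem ofReal_jb_add_rpow_le {d : ℕ} {s : ℝ} (hs : 0 ≤ s) (k m : Fin d → ℤ) :
    ENNReal.ofReal (jb (k + m) ^ s) ≤
      ENNReal.ofReal (2 ^ s) * (ENNReal.ofReal (jb k ^ s) + ENNReal.ofReal (jb m ^ s)) := by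
  have hj (k : Fin d → ℤ) : 0 ≤ jb k := Real.sqrt_nonneg _
  have hk := hj k
  have hm := hj m
  have hmax : jb (k + m) ≤ 2 * max (jb k) (jb m) := by
    linarith [jb_add_le k m, le_max_left (jb k) (jb m), le_max_right (jb k) (jb m)]
  rw [← ENNReal.ofReal_add (by positivity) (by positivity), ← ENNReal.ofReal_mul (by positivity)]
  refine ENNReal.ofReal_le_ofReal ((Real.rpow_le_rpow (hj _) hmax hs).trans ?_)
  rw [Real.mul_rpow zero_le_two (by positivity)]
  gcongr
  rcases max_cases (jb k) (jb m) with ⟨h, -⟩ | ⟨h, -⟩ <;> rw [h]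
  · exact le_add_of_nonneg_right (by positivity)
  · exact le_add_of_nonneg_left (by positivity)

theorem wnorm_conv_le {d : ℕ} {q : ℝ≥0∞} (hq : 1 ≤ q) (hq' : q ≠ ∞) {s : ℝ} (hs : 0 ≤ s)
    (a b : (Fin d → ℤ) → ℂ) :
    wnorm d q s (fun k => ∑' m, a (k - m) * b m) ≤ ENNReal.ofReal (2 ^ s) *
      (wnorm d q s a * ∑' m, ‖b m‖ₑ + (∑' m, ‖a m‖ₑ) * wnorm d q s b) := by
  have hp1 : 1 ≤ q.toReal := by simpa using ENNReal.toReal_mono hq' hq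
  simp only [wnorm_eq hq']
  set p := q.toReal
  have hp0 : 0 < p := by linarith
  set W : (Fin d → ℤ) → ℝ≥0∞ := fun k => ENNReal.ofReal (jb k ^ s)
  set T := ENNReal.ofReal (2 ^ s)
  set F : (Fin d → ℤ) → ℝ≥0∞ := fun k => ∑' m, W (k - m) * ‖a (k - m)‖ₑ * ‖b m‖ₑ
  set H : (Fin d → ℤ) → ℝ≥0∞ := fun k => ∑' m, W (k - m) * ‖b (k - m)‖ₑ * ‖a m‖ₑ
  have hH (k : Fin d → ℤ) : ∑' m, ‖a (k - m)‖ₑ * (W m * ‖b m‖ₑ) = H k := by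
    rw [← (Equiv.subLeft k).tsum_eq]
    simp [H, mul_comm]
  have hpt (k : Fin d → ℤ) : W k * ‖∑' m, a (k - m) * b m‖ₑ ≤ T * (F k + H k) := by
    calc W k * ‖∑' m, a (k - m) * b m‖ₑ
        ≤ W k * ∑' m, ‖a (k - m) * b m‖ₑ := by gcongr; exact enorm_tsum_le_tsum_enorm
      _ = ∑' m, W k * (‖a (k - m)‖ₑ * ‖b m‖ₑ) := by simp_rw [enorm_mul, ENNReal.tsum_mul_left]
      _ ≤ ∑' m, T * (W (k - m) * ‖a (k - m)‖ₑ * ‖b m‖ₑ + ‖a (k - m)‖ₑ * (W m * ‖b m‖ₑ)) := by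
          refine ENNReal.tsum_le_tsum fun m => ?_
          have := ofReal_jb_add_rpow_le hs (k - m) m
          rw [sub_add_cancel] at this
          calc W k * (‖a (k - m)‖ₑ * ‖b m‖ₑ)
              ≤ T * (W (k - m) + W m) * (‖a (k - m)‖ₑ * ‖b m‖ₑ) := by gcongr
            _ = _ := by ring
      _ = T * (F k + H k) := by rw [ENNReal.tsum_mul_left, ENNReal.tsum_add, hH]
  calc (∑' k, (W k * ‖∑' m, a (k - m) * b m‖ₑ) ^ p) ^ (1 / p)
      ≤ (∑' k, (T * (F k + H k)) ^ p) ^ (1 / p) := by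
        gcongr (∑' k, ?_ ^ p) ^ (1 / p) with k
        exact hpt k
    _ = T * (∑' k, (F k + H k) ^ p) ^ (1 / p) := by
        simp_rw [ENNReal.mul_rpow_of_nonneg _ _ hp0.le, ENNReal.tsum_mul_left]
        rw [ENNReal.mul_rpow_of_nonneg _ _ (by positivity), ← ENNReal.rpow_mul,
          mul_one_div_cancel hp0.ne', ENNReal.rpow_one]
    _ ≤ _ := by
        gcongr
        refine (ENNReal.Lp_add_le_tsum hp1 F H).trans (add_le_add ?_ ?_)
        · exact ENNReal.Lp_tsum_conv_le hp1 (fun k => W k * ‖a k‖ₑ) fun m => ‖b m‖ₑ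
        · rw [mul_comm]
          exact ENNReal.Lp_tsum_conv_le hp1 (fun k => W k * ‖b k‖ₑ) fun m => ‖a m‖ₑ

/-- for `1 ≤ q < ∞` and sufficiently large `s`, the weighted sequence space
`l^q_s(ℤ^d)` is a Banach algebra under convolution: convolutions converge absolutely and
`‖a ∗ b‖_{q,s} ≤ C ‖a‖_{q,s} ‖b‖_{q,s}`. -/
theorem algebra_property_lqs (d : ℕ) (hd : 1 ≤ d) (q : ℝ≥0∞) (hq : 1 ≤ q) (hq' : q ≠ ∞)
    (s : ℝ) (hs : SuffLarge d q s) :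
    ∃ C : ℝ, 0 < C ∧ ∀ a b : (Fin d → ℤ) → ℂ,
      wnorm d q s a < ∞ → wnorm d q s b < ∞ →
      (∀ k : Fin d → ℤ, Summable (fun m => ‖a (k - m) * b m‖)) ∧
      wnorm d q s (fun k => ∑' m, a (k - m) * b m) ≤
        ENNReal.ofReal C * (wnorm d q s a * wnorm d q s b) := by
  have hp1 : 1 ≤ q.toReal := by simpa using ENNReal.toReal_mono hq' hq
  obtain ⟨K, hK, hemb⟩ := exists_tsum_le_mul_wnorm hq hq' hs
  refine ⟨2 ^ s * (2 * K.toReal) + 1, by positivity, fun a b ha hb => ⟨fun k => ?_, ?_⟩⟩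
  · have hfin {c : (Fin d → ℤ) → ℂ} (hc : wnorm d q s c < ∞) : ∑' m, ‖c m‖ₑ ≠ ∞ :=
      ((hemb c).trans_lt (ENNReal.mul_lt_top hK.lt_top hc)).ne
    have hle : ∑' m, ‖a (k - m) * b m‖ₑ ≤ (∑' m, ‖a m‖ₑ) * ∑' m, ‖b m‖ₑ := by
      rw [← ENNReal.tsum_mul_left]
      refine ENNReal.tsum_le_tsum fun m => ?_
      rw [enorm_mul]
      gcongr
      exact ENNReal.le_tsum (f := fun m => ‖a m‖ₑ) (k - m)
    have hne := ne_top_of_le_ne_top (ENNReal.mul_ne_top (hfin ha) (hfin hb)) hle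
    simpa using ENNReal.summable_toReal hne
  · calc wnorm d q s (fun k => ∑' m, a (k - m) * b m)
        ≤ ENNReal.ofReal (2 ^ s) *
            (wnorm d q s a * ∑' m, ‖b m‖ₑ + (∑' m, ‖a m‖ₑ) * wnorm d q s b) :=
          wnorm_conv_le hq hq' (hs.nonneg hp1) a b
      _ ≤ ENNReal.ofReal (2 ^ s) * (wnorm d q s a * (K * wnorm d q s b) +
            K * wnorm d q s a * wnorm d q s b) := by gcongr <;> exact hemb _
      _ = ENNReal.ofReal (2 ^ s * (2 * K.toReal)) * (wnorm d q s a * wnorm d q s b) := by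
          rw [ENNReal.ofReal_mul (by positivity), ENNReal.ofReal_mul zero_le_two,
            ENNReal.ofReal_toReal hK, ENNReal.ofReal_ofNat]
          ring
      _ ≤ _ := by
          gcongr
          linarith
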